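/- Let A and B be finite nonempty subsets of an abelian group G with |A| = |B| and A ∩ (A + B) = ∅. If B is a Sidon set, then there exists an acyclic matching from A to B. -/

import Mathlib

open Finset Pointwise

/-- A matching from `A` to `B` is a bijection `f : A → B` with `a + f a ∉ A` for all `a ∈ A`. -/
def IsMatchingFrom {G : Type*} [AddCommGroup G] (A B : Finset G) (f : A ≃ B) : Prop :=
  ∀ a : A, (a : G) + (f a : G) ∉ A

/-- The multiplicity function of a bijection `f : A → B`:
`m_f x = |{a ∈ A : a + f a = x}|`. -/
noncomputable def multiplicityFn {G : Type*} [AddCommGroup G] (A B : Finset G)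
    (f : A ≃ B) : G → ℕ :=
  fun x => Nat.card {a : A // (a : G) + (f a : G) = x}

/-- A matching `f : A → B` is acyclic if every matching `g : A → B` with `m_g = m_f`
equals `f`. -/
def IsAcyclicMatchingFrom {G : Type*} [AddCommGroup G] (A B : Finset G) (f : A ≃ B) : Prop :=
  IsMatchingFrom A B f ∧
    ∀ g : A ≃ B, IsMatchingFrom A B g → multiplicityFn A B g = multiplicityFn A B f → g = f

/-- If `#A ≤ #B`, some injection `A → B` is determined among all such injections by the sizes of
the fibres of `a ↦ a + f a`. It is built greedily: for some `x ∈ A + B`, send every `a ∈ A` with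
`x - a ∈ B` to `x - a`, and recurse on what is left of `A` and `B`. -/
theorem exists_injOn_determined_by_card_fibers {G : Type*} [AddCommGroup G] [DecidableEq G]
    (A B : Finset G) (hcard : #A ≤ #B) :
    ∃ f : G → G, Set.MapsTo f A B ∧ Set.InjOn f A ∧
      ∀ g : G → G, Set.MapsTo g A B → Set.InjOn g A →
        (∀ x, #{a ∈ A | a + g a = x} = #{a ∈ A | a + f a = x}) → Set.EqOn g f A := by
  induction A using Finset.strongInduction generalizing B with
  | H A ih =>
  obtain rfl | ⟨a₀, ha₀⟩ := A.eq_empty_or_nonempty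
  · exact ⟨id, by simp [Set.MapsTo]⟩
  obtain ⟨b₀, hb₀⟩ : B.Nonempty := card_pos.mp ((card_pos.mpr ⟨a₀, ha₀⟩).trans_le hcard)
  let x := a₀ + b₀
  let L : Finset G := {a ∈ A | x - a ∈ B}
  let M : Finset G := L.image (x - ·)
  have hL : ∀ a, a ∈ L ↔ a ∈ A ∧ x - a ∈ B := fun a => mem_filter
  have hM : ∀ a, x - a ∈ M ↔ a ∈ L := fun a => by simp [M]
  have hLA : L ⊆ A := filter_subset _ _
  have hMB : M ⊆ B := image_subset_iff.mpr fun a ha => ((hL a).mp ha).2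
  have hLM : #M = #L := card_image_of_injective _ sub_right_injective
  have ha₀L : a₀ ∈ L := (hL a₀).mpr ⟨ha₀, by simpa [x] using hb₀⟩
  obtain ⟨f', hf'm, hf'i, hf'u⟩ := ih (A \ L) (sdiff_ssubset hLA ⟨a₀, ha₀L⟩) (B \ M) (by
    rw [card_sdiff_of_subset hLA, card_sdiff_of_subset hMB, hLM]
    exact Nat.sub_le_sub_right hcard _)
  let f : G → G := fun a => if a ∈ L then x - a else f' a
  have hfL : ∀ a ∈ L, f a = x - a := fun a ha => if_pos ha
  have hfL' : ∀ a ∉ L, f a = f' a := fun a ha => if_neg ha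
  have hf'mem : ∀ a ∈ A, a ∉ L → f' a ∈ B ∧ f' a ∉ M := fun a ha haL =>
    mem_sdiff.mp (hf'm (mem_sdiff.mpr ⟨ha, haL⟩))
  have hfm : Set.MapsTo f A B := by
    intro a ha
    by_cases haL : a ∈ L
    · rw [hfL a haL]
      exact ((hL a).mp haL).2
    · rw [hfL' a haL]
      exact (hf'mem a ha haL).1
  have hfi : Set.InjOn f A := by
    intro a ha b hb hab
    by_cases haL : a ∈ L <;> by_cases hbL : b ∈ L
    · rw [hfL a haL, hfL b hbL] at hab
      exact sub_right_injective hab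
    · rw [hfL a haL, hfL' b hbL] at hab
      exact absurd (hab ▸ (hM a).mpr haL) (hf'mem b hb hbL).2
    · rw [hfL' a haL, hfL b hbL] at hab
      exact absurd (hab ▸ (hM b).mpr hbL) (hf'mem a ha haL).2
    · rw [hfL' a haL, hfL' b hbL] at hab
      exact hf'i (mem_sdiff.mpr ⟨ha, haL⟩) (mem_sdiff.mpr ⟨hb, hbL⟩) hab
  refine ⟨f, hfm, hfi, fun g hgm hgi hgf => ?_⟩
  have fiber_subset : ∀ h : G → G, Set.MapsTo h A B → {a ∈ A | a + h a = x} ⊆ L := by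
    intro h hh a ha
    obtain ⟨haA, hax⟩ := mem_filter.mp ha
    exact (hL a).mpr ⟨haA, by rw [← hax, add_sub_cancel_left]; exact hh haA⟩
  have hfx : {a ∈ A | a + f a = x} = L := (fiber_subset f hfm).antisymm fun a ha =>
    mem_filter.mpr ⟨hLA ha, by rw [hfL a ha, add_sub_cancel]⟩
  have hgx : {a ∈ A | a + g a = x} = L :=
    eq_of_subset_of_card_le (fiber_subset g hgm) (by rw [hgf, hfx])
  have hgL : ∀ a ∈ L, g a = x - a := by
    intro a ha
    rw [← hgx] at ha
    exact eq_sub_of_add_eq' (mem_filter.mp ha).2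
  have hgu : Set.EqOn g f' ↑(A \ L) := by
    refine hf'u g (fun a ha => ?_) (hgi.mono (by exact_mod_cast sdiff_subset)) fun y => ?_
    · obtain ⟨haA, haL⟩ := mem_sdiff.mp ha
      refine mem_sdiff.mpr ⟨hgm haA, fun hga => ?_⟩
      obtain ⟨l, hl, hlg⟩ := mem_image.mp hga
      rw [← hgL l hl] at hlg
      exact haL (hgi (hLA hl) haA hlg ▸ hl)
    · have hy := hgf y
      simp only [card_filter] at hy ⊢
      rw [← sum_sdiff hLA, ← sum_sdiff hLA,
        sum_congr (s₁ := L) rfl fun a ha => by rw [hgL a ha, ← hfL a ha]] at hy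
      rw [add_right_cancel hy]
      exact sum_congr rfl fun a ha => by rw [hfL' a (mem_sdiff.mp ha).2]
  intro a ha
  by_cases haL : a ∈ L
  · rw [hgL a haL, hfL a haL]
  · rw [hfL' a haL]
    exact hgu (mem_sdiff.mpr ⟨ha, haL⟩)

theorem multiplicityFn_eq_card_filter {G : Type*} [AddCommGroup G] [DecidableEq G]
    {A B : Finset G} (f : A ≃ B) (h : G → G) (hf : ∀ a : A, (f a : G) = h a) (x : G) :
    multiplicityFn A B f x = #{a ∈ A | a + h a = x} := by
  rw [multiplicityFn, ← Nat.card_eq_finsetCard]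
  refine Nat.card_congr
    { toFun := fun a => ⟨a.1, mem_filter.mpr ⟨a.1.2, by rw [← hf]; exact a.2⟩⟩
      invFun := fun a => ⟨⟨a.1, (mem_filter.mp a.2).1⟩, by
        rw [hf]; exact (mem_filter.mp a.2).2⟩
      left_inv := fun _ => rfl
      right_inv := fun _ => rfl }

/-- If `A, B` are finite nonempty subsets of an abelian group `G` with
`|A| = |B|` and `A ∩ (A + B) = ∅`, and `B` is a Sidon set (the equation `x + y = z + w`
has no solution in `B` with `{x, y} ∩ {z, w} = ∅`), then there exists an acyclic matching
from `A` to `B`. -/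
theorem sidon_acyclic_matching {G : Type*} [AddCommGroup G] [DecidableEq G]
    (A B : Finset G) (hA : A.Nonempty) (hB : B.Nonempty)
    (hcard : A.card = B.card) (hdisj : A ∩ (A + B) = ∅)
    (hSidon : ∀ x ∈ B, ∀ y ∈ B, ∀ z ∈ B, ∀ w ∈ B,
      x + y = z + w → (x = z ∨ x = w ∨ y = z ∨ y = w)) :
    ∃ f : A ≃ B, IsAcyclicMatchingFrom A B f := by
  obtain ⟨f, hfm, hfi, hfu⟩ := exists_injOn_determined_by_card_fibers A B hcard.le
  have hbij : Function.Bijective (hfm.restrict f A B) :=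
    (Fintype.bijective_iff_injective_and_card _).mpr
      ⟨hfm.restrict_inj.mpr hfi, by simpa using hcard⟩
  let F : A ≃ B := Equiv.ofBijective _ hbij
  have hF : ∀ a : A, (F a : G) = f a := fun _ => rfl
  refine ⟨F, fun a ha => ?_, fun g _ hgF => ?_⟩
  · have hmem := mem_inter.mpr ⟨ha, add_mem_add a.2 (F a).2⟩
    simp [hdisj] at hmem
  · let g' : G → G := fun a => if h : a ∈ A then g ⟨a, h⟩ else a
    have hg : ∀ a : A, (g a : G) = g' a := fun a => by simp [g']
    have hgf : Set.EqOn g' f A := by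
      refine hfu g' (fun a ha => ?_) (fun a ha b hb hab => ?_) fun x => ?_
      · rw [← hg ⟨a, ha⟩]
        exact (g ⟨a, ha⟩).2
      · rw [← hg ⟨a, ha⟩, ← hg ⟨b, hb⟩] at hab
        exact congrArg Subtype.val (g.injective (Subtype.ext hab))
      · rw [← multiplicityFn_eq_card_filter g g' hg, ← multiplicityFn_eq_card_filter F f hF, hgF]
    ext a
    rw [hg, hF]
    exact hgf a.2
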